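/- arXiv:2108.11434 — 3 statements merged into one kernel-verified Lean document; each statement's English description precedes it below -/
import Mathlib

section
/- Let N ≥ 1, 0 < b < 2, and let k be an integer with k > 3 − b and k ≥ 2. For R > 0 define on the interval R < r ≤ R(1 + (1/k)^{1/(k−1)}) the function Ψ_R(r) = [ (4/(N+2−b)) (r/R − 1)^{k−1} ( k(2−b) + (2N−2+b)(1 − R/r) ) ]^{1/(2−b)}. Then there exists a constant C > 0, depending only on N, b and k (in particular independent of R), such that |Ψ_R'(r)| ≤ C/R for all R > 0 and all r with R < r ≤ R(1 + (1/k)^{1/(k−1)}). -/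
/-- Up to a bounded factor, a real power `(A t ^ m g) ^ p` with `1 ≤ m p` is at most linear in
`t ∈ [0, 1]`. -/
lemma rpow_mul_pow_le {A G g t p : ℝ} {m : ℕ} (hA : 0 ≤ A) (hg : 0 ≤ g) (hgG : g ≤ G)
    (ht0 : 0 < t) (ht1 : t ≤ 1) (hp : 0 ≤ p) (hmp : 1 ≤ (m : ℝ) * p) :
    (A * t ^ m * g) ^ p ≤ (A * G) ^ p * t := by
  have hG : 0 ≤ G := hg.trans hgG
  calc (A * t ^ m * g) ^ p ≤ (A * t ^ m * G) ^ p := by gcongr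
    _ = (A * G) ^ p * (t ^ m) ^ p := by
        rw [← Real.mul_rpow (by positivity) (by positivity)]; ring_nf
    _ = (A * G) ^ p * t ^ ((m : ℝ) * p) := by
        rw [← Real.rpow_natCast, ← Real.rpow_mul ht0.le]
    _ ≤ (A * G) ^ p * t := by
        gcongr
        simpa using Real.rpow_le_rpow_of_exponent_ge ht0 ht1 hmp

/-- The derivative of `s ↦ (A (s / R - 1) ^ m (B + D (1 - R / s))) ^ p` for `R < r`, written
through the logarithmic derivative. -/
lemma hasDerivAt_cutoff_rpow {A B D R r p : ℝ} {m : ℕ} (hA : 0 < A) (hB : 0 < B) (hD : 0 ≤ D)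
    (hR : 0 < R) (hr : R < r) :
    HasDerivAt (fun s : ℝ => (A * (s / R - 1) ^ m * (B + D * (1 - R / s))) ^ p)
      (p * (A * (r / R - 1) ^ m * (B + D * (1 - R / r))) ^ p *
        (m / ((r / R - 1) * R) + D * R / (r ^ 2 * (B + D * (1 - R / r))))) r := by
  have hr0 : 0 < r := hR.trans hr
  have ht : 0 < r / R - 1 := sub_pos.2 ((one_lt_div hR).2 hr)
  have hg : 0 < B + D * (1 - R / r) := by
    have : 0 ≤ 1 - R / r := sub_nonneg.2 ((div_le_one hr0).2 hr.le)
    positivity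
  have h1 : HasDerivAt (fun s : ℝ => s / R - 1) (1 / R) r :=
    ((hasDerivAt_id r).div_const R).sub_const 1
  have h2 : HasDerivAt (fun s : ℝ => B + D * (1 - R / s)) (D * R / r ^ 2) r := by
    have h := ((((hasDerivAt_inv hr0.ne').const_mul R).const_sub 1).const_mul D).const_add B
    simp only [div_eq_mul_inv]
    exact h.congr_deriv (by ring)
  have hf : 0 < A * (r / R - 1) ^ m * (B + D * (1 - R / r)) := by positivity
  have h := (((h1.fun_pow m).const_mul A).fun_mul h2).rpow_const (p := p) (Or.inl hf.ne')
  convert h using 1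
  rw [Real.rpow_sub_one hf.ne']
  generalize (A * (r / R - 1) ^ m * (B + D * (1 - R / r))) ^ p = F
  generalize B + D * (1 - R / r) = g at *
  generalize r / R - 1 = t at *
  rcases m with _ | m
  · simp only [Nat.cast_zero, pow_zero, zero_div, zero_mul, mul_zero, mul_one, zero_add]
    field_simp
  · simp only [Nat.add_sub_cancel, pow_succ]
    field_simp


/-- A uniform bound `|Ψ_R'(r)| ≤ C/R` on `R < r ≤ R(1 + (1/k)^{1/(k-1)})` for
`Ψ_R(r) = [(4/(N+2-b)) (r/R-1)^{k-1} (k(2-b) + (2N-2+b)(1 - R/r))]^{1/(2-b)}`,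
with `C` depending only on `N`, `b`, `k` (independent of `R`). -/
theorem stmt_7 (N : ℕ) (hN : 1 ≤ N) (b : ℝ) (hb0 : 0 < b) (hb2 : b < 2)
    (k : ℕ) (hk2 : 2 ≤ k) (hk : 3 - b < (k : ℝ)) :
    ∃ C : ℝ, 0 < C ∧
      ∀ R : ℝ, 0 < R → ∀ r : ℝ, R < r →
        r ≤ R * (1 + (1 / (k : ℝ)) ^ ((1 : ℝ) / ((k : ℝ) - 1))) →
        |deriv (fun s : ℝ =>
            ((4 / ((N : ℝ) + 2 - b)) * (s / R - 1) ^ (k - 1) *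
              ((k : ℝ) * (2 - b) + (2 * (N : ℝ) - 2 + b) * (1 - R / s)))
              ^ (1 / (2 - b))) r| ≤ C / R := by
  have hN' : (1 : ℝ) ≤ N := by exact_mod_cast hN
  have hk2' : (2 : ℝ) ≤ k := by exact_mod_cast hk2
  set A : ℝ := 4 / ((N : ℝ) + 2 - b)
  set B : ℝ := (k : ℝ) * (2 - b)
  set D : ℝ := 2 * (N : ℝ) - 2 + b
  set p : ℝ := 1 / (2 - b) with hp_def
  have hA : 0 < A := div_pos (by norm_num) (by linarith)
  have hB : 0 < B := mul_pos (by linarith) (by linarith)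
  have hD : 0 < D := by simp only [D]; linarith
  have hp : 0 < p := one_div_pos.2 (by linarith)
  have hm : ((k - 1 : ℕ) : ℝ) = k - 1 := by
    rw [Nat.cast_sub (by omega), Nat.cast_one]
  have hmp : 1 ≤ ((k - 1 : ℕ) : ℝ) * p := by
    rw [hm, hp_def, mul_one_div, one_le_div (by linarith)]
    linarith
  refine ⟨p * (A * (B + D)) ^ p * ((k - 1 : ℕ) + D / B), by positivity, ?_⟩
  intro R hR r hr hrT
  have hr0 : 0 < r := hR.trans hr
  have ht : 0 < r / R - 1 := sub_pos.2 ((one_lt_div hR).2 hr)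
  have ht1 : r / R - 1 ≤ 1 := by
    have hT : (1 / (k : ℝ)) ^ ((1 : ℝ) / ((k : ℝ) - 1)) ≤ 1 :=
      Real.rpow_le_one (by positivity) ((div_le_one (by linarith)).2 (by linarith))
        (one_div_nonneg.2 (by linarith))
    have : r / R ≤ 1 + (1 / (k : ℝ)) ^ ((1 : ℝ) / ((k : ℝ) - 1)) := by
      rwa [div_le_iff₀' hR]
    linarith
  have hq : 0 ≤ 1 - R / r := sub_nonneg.2 ((div_le_one hr0).2 hr.le)
  have hq1 : 1 - R / r ≤ 1 := sub_le_self _ (by positivity)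
  have hgB : B ≤ B + D * (1 - R / r) := le_add_of_nonneg_right (by positivity)
  have hgG : B + D * (1 - R / r) ≤ B + D := by
    gcongr
    exact mul_le_of_le_one_right hD.le hq1
  rw [(hasDerivAt_cutoff_rpow hA hB hD.le hR hr).deriv]
  have hF := rpow_mul_pow_le hA.le (hB.le.trans hgB) hgG ht ht1 hp.le hmp
  generalize B + D * (1 - R / r) = g at *
  have hg : 0 < g := hB.trans_le hgB
  rw [abs_of_nonneg (by positivity)]
  have hsecond : (r / R - 1) * (D * R / (r ^ 2 * g)) ≤ D / B / R :=
    calc (r / R - 1) * (D * R / (r ^ 2 * g)) ≤ 1 * (D * R / (R ^ 2 * B)) := by gcongr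
      _ = D / B / R := by field_simp
  calc p * (A * (r / R - 1) ^ (k - 1) * g) ^ p *
        (((k - 1 : ℕ) : ℝ) / ((r / R - 1) * R) + D * R / (r ^ 2 * g))
      ≤ p * ((A * (B + D)) ^ p * (r / R - 1)) *
        (((k - 1 : ℕ) : ℝ) / ((r / R - 1) * R) + D * R / (r ^ 2 * g)) := by gcongr
    _ = p * (A * (B + D)) ^ p *
        (((k - 1 : ℕ) : ℝ) / R + (r / R - 1) * (D * R / (r ^ 2 * g))) := by
        generalize r / R - 1 = t at *
        field_simp
    _ ≤ p * (A * (B + D)) ^ p * (((k - 1 : ℕ) : ℝ) / R + D / B / R) := by gcongr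
    _ = p * (A * (B + D)) ^ p * ((k - 1 : ℕ) + D / B) / R := by ring
end

section
/- Let N ≥ 1, 0 < b < 2, let k be an integer with k > 2/b and k ≥ 2, and let c > 0. Then there exists ε > 0, depending only on N, b, k and c (in particular independent of R), such that for all R > 0 and all r with R < r ≤ R(1 + (1/k)^{1/(k−1)}) one has c ε [ (4/(N+2−b)) (r/R − 1)^{k−1} ( k(2−b) + (2N−2+b)(1 − R/r) ) ]^{2/(2−b)} ≤ 8 (R/r) (r/R − 1)^k. -/
/-- Smallness estimate `c ε Φ_{2,R}(r)^{2/(2-b)} ≤ Φ_{1,R}(r)` on the intermediate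
region `R < r ≤ R(1 + (1/k)^{1/(k-1)})`, with `ε` independent of `R`. -/
theorem stmt_8 (N : ℕ) (hN : 1 ≤ N) (b : ℝ) (hb0 : 0 < b) (hb2 : b < 2)
    (k : ℕ) (hk2 : 2 ≤ k) (hk : 2 / b < (k : ℝ)) (c : ℝ) (hc : 0 < c) :
    ∃ ε : ℝ, 0 < ε ∧
      ∀ R : ℝ, 0 < R → ∀ r : ℝ, R < r →
        r ≤ R * (1 + (1 / (k : ℝ)) ^ ((1 : ℝ) / ((k : ℝ) - 1))) →
        c * ε * ((4 / ((N : ℝ) + 2 - b)) * (r / R - 1) ^ (k - 1) *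
            ((k : ℝ) * (2 - b) + (2 * (N : ℝ) - 2 + b) * (1 - R / r))) ^ (2 / (2 - b)) ≤
          8 * (R / r) * (r / R - 1) ^ k := by
  have hN' : (1 : ℝ) ≤ N := by exact_mod_cast hN
  have hk' : (2 : ℝ) ≤ k := by exact_mod_cast hk2
  have hkb : 2 < k * b := (div_lt_iff₀ hb0).1 hk
  have h2b : 0 < 2 - b := by linarith
  have hp : 0 < 2 / (2 - b) := by positivity
  have hexp : (k : ℝ) ≤ ((k - 1 : ℕ) : ℝ) * (2 / (2 - b)) := by
    rw [Nat.cast_sub (by omega), ← mul_div_assoc, le_div_iff₀ h2b]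
    push_cast
    nlinarith
  set p := 2 / (2 - b)
  set M : ℝ := k * (2 - b) + (2 * N - 2 + b) with hM
  have hD : 0 < 4 / ((N : ℝ) + 2 - b) := div_pos (by norm_num) (by linarith)
  set D := 4 / ((N : ℝ) + 2 - b)
  have hMpos : 0 < M := by
    have : 0 < (k : ℝ) * (2 - b) := by positivity
    linarith
  have hCp : 0 < (D * M) ^ p := Real.rpow_pos_of_pos (by positivity) _
  refine ⟨4 / (c * (D * M) ^ p), by positivity, fun R hR r hr hr' => ?_⟩
  have hr0 : 0 < r := hR.trans hr
  have hroot : (1 / (k : ℝ)) ^ ((1 : ℝ) / ((k : ℝ) - 1)) ≤ 1 := by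
    refine Real.rpow_le_one (by positivity) ?_ (div_nonneg zero_le_one (by linarith))
    rw [div_le_one (by linarith)]
    linarith
  have hr2 : r ≤ 2 * R := by nlinarith
  have hx0 : 0 < r / R - 1 := by
    rw [sub_pos, one_lt_div hR]
    exact hr
  have hx1 : r / R - 1 ≤ 1 := by
    have : r / R ≤ 2 := (div_le_iff₀ hR).2 hr2
    linarith
  have hq : 1 / 2 ≤ R / r := by
    rw [le_div_iff₀ hr0]
    linarith
  have hq1 : R / r ≤ 1 := (div_le_one hr0).2 hr.le
  set x := r / R - 1
  set q := R / r
  have hA0 : 0 ≤ (k : ℝ) * (2 - b) + (2 * (N : ℝ) - 2 + b) * (1 - q) :=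
    add_nonneg (by positivity) (mul_nonneg (by linarith) (by linarith))
  have hAM : (k : ℝ) * (2 - b) + (2 * (N : ℝ) - 2 + b) * (1 - q) ≤ M := by
    have : 0 ≤ (2 * (N : ℝ) - 2 + b) * q := mul_nonneg (by linarith) (by linarith)
    rw [hM]
    linarith
  have hpow : (x ^ (k - 1)) ^ p ≤ x ^ k := by
    rw [← Real.rpow_natCast x (k - 1), ← Real.rpow_mul hx0.le, ← Real.rpow_natCast x k]
    exact Real.rpow_le_rpow_of_exponent_ge hx0 hx1 hexp
  calc _ ≤ c * (4 / (c * (D * M) ^ p)) * (D * x ^ (k - 1) * M) ^ p := by gcongr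
    _ = c * (4 / (c * (D * M) ^ p)) * ((D * M) ^ p * (x ^ (k - 1)) ^ p) := by
      rw [← Real.mul_rpow (by positivity) (by positivity), mul_right_comm D]
    _ = 4 * (x ^ (k - 1)) ^ p := by field_simp
    _ ≤ 4 * x ^ k := by gcongr
    _ ≤ 8 * q * x ^ k := by gcongr; linarith
end

section
/- Let N = 2, 0 < b < 2, let k be an integer with k > 4/b and k ≥ 2, and let c > 0. Then there exists ε > 0, depending only on b, k and c (in particular independent of R), such that for all R > 0 and all r with R < r ≤ R(1 + (1/k)^{1/(k−1)}) one has c ε [ (4/(4−b)) (r/R − 1)^{k−1} ( k(2−b) + (2+b)(1 − R/r) ) ]^{2/(2−b/2)} ≤ 8 (R/r) (r/R − 1)^k. -/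
/-- Two-dimensional smallness estimate `c ε Φ_{2,R}(r)^{2/(2-b/2)} ≤ Φ_{1,R}(r)` on the
intermediate region `R < r ≤ R(1 + (1/k)^{1/(k-1)})`, with `ε` independent of `R`. -/
theorem stmt_9 (b : ℝ) (hb0 : 0 < b) (hb2 : b < 2)
    (k : ℕ) (hk2 : 2 ≤ k) (hk : 4 / b < (k : ℝ)) (c : ℝ) (hc : 0 < c) :
    ∃ ε : ℝ, 0 < ε ∧
      ∀ R : ℝ, 0 < R → ∀ r : ℝ, R < r →
        r ≤ R * (1 + (1 / (k : ℝ)) ^ ((1 : ℝ) / ((k : ℝ) - 1))) →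
        c * ε * ((4 / (4 - b)) * (r / R - 1) ^ (k - 1) *
            ((k : ℝ) * (2 - b) + (2 + b) * (1 - R / r))) ^ (2 / (2 - b / 2)) ≤
          8 * (R / r) * (r / R - 1) ^ k := by
  have h4b : 0 < 4 - b := by linarith
  have hk2' : (2 : ℝ) ≤ k := by exact_mod_cast hk2
  have hkb : 4 < k * b := (div_lt_iff₀ hb0).mp hk
  have hp : 0 < 2 / (2 - b / 2) := div_pos two_pos (by linarith)
  have hexp : (k : ℝ) ≤ ((k - 1 : ℕ) : ℝ) * (2 / (2 - b / 2)) := by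
    rw [Nat.cast_sub (by lia), Nat.cast_one, ← mul_div_assoc, le_div_iff₀ (by linarith)]
    nlinarith
  set p : ℝ := 2 / (2 - b / 2)
  set D : ℝ := 4 / (4 - b) * (2 * k + 4) with hD
  have hA : 0 < 4 / (4 - b) := by positivity
  have hDp : 0 < D ^ p := Real.rpow_pos_of_pos (by positivity) p
  refine ⟨4 / (c * D ^ p), by positivity, fun R hR r hRr hr => ?_⟩
  have hr0 : 0 < r := hR.trans hRr
  have hroot : (1 / (k : ℝ)) ^ ((1 : ℝ) / ((k : ℝ) - 1)) ≤ 1 :=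
    Real.rpow_le_one (by positivity) (by rw [div_le_one (by linarith)]; linarith)
      (div_nonneg zero_le_one (by linarith))
  have hr2 : r ≤ 2 * R := by nlinarith
  have hs0 : 0 < r / R - 1 := by rw [sub_pos, one_lt_div hR]; exact hRr
  have hs1 : r / R - 1 ≤ 1 := by
    have : r / R ≤ 2 := (div_le_iff₀ hR).mpr hr2
    linarith
  have hq : 1 / 2 ≤ R / r := by rw [div_le_div_iff₀ two_pos hr0]; linarith
  have hq1 : R / r ≤ 1 := (div_le_one hr0).mpr hRr.le
  generalize R / r = q at hq hq1 ⊢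
  generalize r / R - 1 = s at hs0 hs1 ⊢
  have hB0 : 0 ≤ k * (2 - b) + (2 + b) * (1 - q) :=
    add_nonneg (mul_nonneg (by positivity) (by linarith))
      (mul_nonneg (by linarith) (by linarith))
  have hB : k * (2 - b) + (2 + b) * (1 - q) ≤ 2 * k + 4 := by nlinarith
  have hpow : (4 / (4 - b) * s ^ (k - 1) * (k * (2 - b) + (2 + b) * (1 - q))) ^ p
      ≤ D ^ p * s ^ k := by
    calc _ ≤ (D * s ^ (k - 1)) ^ p := by
          refine Real.rpow_le_rpow (by positivity) ?_ hp.le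
          rw [hD, mul_right_comm]
          gcongr
      _ = D ^ p * s ^ (((k - 1 : ℕ) : ℝ) * p) := by
          rw [Real.mul_rpow (by positivity) (by positivity), Real.rpow_mul hs0.le,
            Real.rpow_natCast]
      _ ≤ D ^ p * s ^ k := by
          rw [← Real.rpow_natCast s k]
          exact mul_le_mul_of_nonneg_left (Real.rpow_le_rpow_of_exponent_ge hs0 hs1 hexp) hDp.le
  calc _ ≤ c * (4 / (c * D ^ p)) * (D ^ p * s ^ k) := by gcongr
    _ = 4 * s ^ k := by field_simp
    _ ≤ 8 * q * s ^ k := by gcongr; linarith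
end
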